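/- Let B' = {(f1,f2,f3) in R3 x R3 x R3 : (y-x) divides f1 - f2, (z-y) divides f2 - f3, and (z-x) divides f1 - f3}, a Q-subalgebra of R3 x R3 x R3, and let A' be the set of triples (f1 + g1*eps, f2 + g2*eps, f3 + g3*eps) in (DualNumber R3)^3 such that (y-x) divides f1 - f2, (z-y) divides f2 - f3, (z-x) divides f1 - f3, (y-x) divides g1 - g2, (z-y) divides g2 - g3, (z-x) divides g1 + g3, and moreover (z-y) divides g1, (z-x) divides g2, (y-x) divides g3. Then A' is a Q-subalgebra of (DualNumber R3)^3, and the map from DualNumber B' to (DualNumber R3)^3 sending (f1,f2,f3) + (h1,h2,h3)*eps to (f1 + h1*(z-y)*eps, f2 + h2*(z-x)*eps, f3 + h3*(y-x)*eps) is an injective Q-algebra homomorphism whose image is exactly A'; in particular A' is isomorphic to DualNumber B' as Q-algebras. -/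

import Mathlib

open MvPolynomial TrivSqZeroExt

set_option synthInstance.maxHeartbeats 1000000
set_option maxHeartbeats 1000000

abbrev R3 : Type := MvPolynomial (Fin 3) ℚ

noncomputable abbrev x : R3 := X 0
noncomputable abbrev y : R3 := X 1
noncomputable abbrev z : R3 := X 2

section XSubX

variable {σ R : Type*} [CommRing R] [DecidableEq σ]

/-- The difference of two variables divides exactly the polynomials that vanish upon
identifying these variables. -/
theorem X_sub_X_dvd_iff_rename_eq_zero (i j : σ) (p : MvPolynomial σ R) :
    X i - X j ∣ p ↔ rename (Function.update id i j) p = 0 := by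
  constructor
  · rintro ⟨q, rfl⟩
    by_cases h : j = i <;> simp [h]
  · intro hp
    have key : (Ideal.Quotient.mkₐ R (Ideal.span {(X i - X j : MvPolynomial σ R)})).comp
        (rename (Function.update id i j)) = Ideal.Quotient.mkₐ R _ := by
      ext k
      by_cases hk : k = i
      · subst hk
        simpa [eq_comm] using (Ideal.Quotient.eq.2
          (Ideal.mem_span_singleton_self (X k - X j : MvPolynomial σ R)))
      · simp [hk]
    have h := DFunLike.congr_fun key p
    rw [AlgHom.comp_apply, hp, map_zero, eq_comm, Ideal.Quotient.mkₐ_eq_mk,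
      Ideal.Quotient.eq_zero_iff_mem, Ideal.mem_span_singleton] at h
    exact h

theorem X_sub_X_dvd_of_dvd_mul [IsDomain R] {i j : σ} {p q : MvPolynomial σ R}
    (hq : ¬ X i - X j ∣ q) (h : X i - X j ∣ p * q) : X i - X j ∣ p := by
  rw [X_sub_X_dvd_iff_rename_eq_zero] at *
  rw [map_mul] at h
  exact (mul_eq_zero.1 h).resolve_right hq

end XSubX

/-- The triples of elements of `R` satisfying congruences modulo `a`, `b`, `c` along the edges
of a triangle. -/
def triangleSubalgebra (k : Type*) {R : Type*} [CommRing k] [CommRing R] [Algebra k R]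
    (a b c : R) : Subalgebra k (R × R × R) where
  carrier := {p | a ∣ p.1 - p.2.1 ∧ b ∣ p.2.1 - p.2.2 ∧ c ∣ p.1 - p.2.2}
  mul_mem' := by
    rintro p q ⟨h₁, h₂, h₃⟩ ⟨k₁, k₂, k₃⟩
    exact ⟨dvd_mul_sub_mul h₁ k₁, dvd_mul_sub_mul h₂ k₂, dvd_mul_sub_mul h₃ k₃⟩
  add_mem' := by
    rintro p q ⟨h₁, h₂, h₃⟩ ⟨k₁, k₂, k₃⟩
    simp only [Set.mem_ofPred_eq, Prod.fst_add, Prod.snd_add, add_sub_add_comm]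
    exact ⟨dvd_add h₁ k₁, dvd_add h₂ k₂, dvd_add h₃ k₃⟩
  algebraMap_mem' r := by simp

/-- The homomorphism of dual numbers `b + h ε ↦ f b + (f h * c) ε`. -/
def DualNumber.mapMul {k B S : Type*} [CommRing k] [CommRing B] [CommRing S] [Algebra k B]
    [Algebra k S] (f : B →ₐ[k] S) (c : S) : DualNumber B →ₐ[k] DualNumber S where
  toFun p := inl (f (fst p)) + inr (f (snd p) * c)
  map_one' := by ext <;> simp
  map_mul' p q := by
    ext <;> simp
    ring
  map_zero' := by ext <;> simp
  map_add' p q := by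
    ext <;> simp
    ring
  commutes' r := by ext <;> simp [TrivSqZeroExt.algebraMap_eq_inl']

theorem stmt_8 :
    ∃ (B : Subalgebra ℚ (R3 × R3 × R3))
      (A : Subalgebra ℚ (DualNumber R3 × DualNumber R3 × DualNumber R3)),
      (B : Set (R3 × R3 × R3)) =
        {p : R3 × R3 × R3 |
          (y - x) ∣ p.1 - p.2.1 ∧ (z - y) ∣ p.2.1 - p.2.2 ∧ (z - x) ∣ p.1 - p.2.2} ∧
      (A : Set (DualNumber R3 × DualNumber R3 × DualNumber R3)) =
        {q : DualNumber R3 × DualNumber R3 × DualNumber R3 |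
          (y - x) ∣ fst q.1 - fst q.2.1 ∧
          (z - y) ∣ fst q.2.1 - fst q.2.2 ∧
          (z - x) ∣ fst q.1 - fst q.2.2 ∧
          (y - x) ∣ snd q.1 - snd q.2.1 ∧
          (z - y) ∣ snd q.2.1 - snd q.2.2 ∧
          (z - x) ∣ snd q.1 + snd q.2.2 ∧
          (z - y) ∣ snd q.1 ∧ (z - x) ∣ snd q.2.1 ∧ (y - x) ∣ snd q.2.2} ∧
      ∃ φ : DualNumber ↥B →ₐ[ℚ] DualNumber R3 × DualNumber R3 × DualNumber R3,
        (∀ p : DualNumber ↥B,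
          fst (φ p).1 = (((fst p : ↥B) : R3 × R3 × R3)).1 ∧
          snd (φ p).1 = (((snd p : ↥B) : R3 × R3 × R3)).1 * (z - y) ∧
          fst (φ p).2.1 = (((fst p : ↥B) : R3 × R3 × R3)).2.1 ∧
          snd (φ p).2.1 = (((snd p : ↥B) : R3 × R3 × R3)).2.1 * (z - x) ∧
          fst (φ p).2.2 = (((fst p : ↥B) : R3 × R3 × R3)).2.2 ∧
          snd (φ p).2.2 = (((snd p : ↥B) : R3 × R3 × R3)).2.2 * (y - x)) ∧
        Function.Injective φ ∧
        φ.range = A ∧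
        Nonempty (DualNumber ↥B ≃ₐ[ℚ] ↥A) := by
  have hyx : ¬ y - x ∣ z - x := by
    simp [X_sub_X_dvd_iff_rename_eq_zero, sub_eq_zero]
  have hzy : ¬ z - y ∣ y - x := by
    simp [X_sub_X_dvd_iff_rename_eq_zero, sub_eq_zero]
  have hzx : ¬ z - x ∣ z - y := by
    simp [X_sub_X_dvd_iff_rename_eq_zero, sub_eq_zero]
  have hyx₀ : y - x ≠ 0 := by simp [sub_eq_zero]
  have hzy₀ : z - y ≠ 0 := by simp [sub_eq_zero]
  have hzx₀ : z - x ≠ 0 := by simp [sub_eq_zero]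
  let B := triangleSubalgebra ℚ (y - x) (z - y) (z - x)
  let φ : DualNumber B →ₐ[ℚ] DualNumber R3 × DualNumber R3 × DualNumber R3 :=
    (DualNumber.mapMul ((AlgHom.fst ℚ R3 (R3 × R3)).comp B.val) (z - y)).prod
      ((DualNumber.mapMul (((AlgHom.fst ℚ R3 R3).comp (AlgHom.snd ℚ R3 (R3 × R3))).comp B.val)
        (z - x)).prod
      (DualNumber.mapMul (((AlgHom.snd ℚ R3 R3).comp (AlgHom.snd ℚ R3 (R3 × R3))).comp B.val)
        (y - x)))
  have hφ : ∀ p : DualNumber B,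
      fst (φ p).1 = ((fst p : B) : R3 × R3 × R3).1 ∧
      snd (φ p).1 = ((snd p : B) : R3 × R3 × R3).1 * (z - y) ∧
      fst (φ p).2.1 = ((fst p : B) : R3 × R3 × R3).2.1 ∧
      snd (φ p).2.1 = ((snd p : B) : R3 × R3 × R3).2.1 * (z - x) ∧
      fst (φ p).2.2 = ((fst p : B) : R3 × R3 × R3).2.2 ∧
      snd (φ p).2.2 = ((snd p : B) : R3 × R3 × R3).2.2 * (y - x) := by
    intro p
    simp [φ, DualNumber.mapMul]
  have hinj : Function.Injective φ := by
    intro p q h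
    obtain ⟨p₁, p₂, p₃, p₄, p₅, p₆⟩ := hφ p
    obtain ⟨q₁, q₂, q₃, q₄, q₅, q₆⟩ := hφ q
    rw [h] at p₁ p₂ p₃ p₄ p₅ p₆
    refine TrivSqZeroExt.ext (Subtype.ext (Prod.ext ?_ (Prod.ext ?_ ?_)))
      (Subtype.ext (Prod.ext ?_ (Prod.ext ?_ ?_)))
    · exact p₁.symm.trans q₁
    · exact p₃.symm.trans q₃
    · exact p₅.symm.trans q₅
    · exact mul_right_cancel₀ hzy₀ (p₂.symm.trans q₂)
    · exact mul_right_cancel₀ hzx₀ (p₄.symm.trans q₄)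
    · exact mul_right_cancel₀ hyx₀ (p₆.symm.trans q₆)
  refine ⟨B, φ.range, rfl, ?_, φ, hφ, hinj, rfl, ⟨AlgEquiv.ofInjective φ hinj⟩⟩
  ext q
  constructor
  · rintro ⟨p, rfl⟩
    obtain ⟨p₁, p₂, p₃, p₄, p₅, p₆⟩ := hφ p
    obtain ⟨f₁, f₂, f₃⟩ := (fst p).2
    obtain ⟨⟨u, hu⟩, ⟨v, hv⟩, ⟨w, hw⟩⟩ := (snd p).2
    simp only [Set.mem_ofPred_eq, RingHom.coe_coe, AlgHom.toRingHom_eq_coe]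
    rw [p₁, p₂, p₃, p₄, p₅, p₆]
    refine ⟨f₁, f₂, f₃, ⟨u * (z - x) - ((snd p : B) : R3 × R3 × R3).1, ?_⟩,
      ⟨v * (y - x) + ((snd p : B) : R3 × R3 × R3).2.1, ?_⟩,
      ⟨w * (z - y) + ((snd p : B) : R3 × R3 × R3).2.2, ?_⟩,
      dvd_mul_left _ _, dvd_mul_left _ _, dvd_mul_left _ _⟩
    · linear_combination (z - x) * hu
    · linear_combination (y - x) * hv
    · linear_combination (z - y) * hw
  · rintro ⟨f₁, f₂, f₃, ⟨u, hu⟩, ⟨v, hv⟩, ⟨w, hw⟩, ⟨h₁, e₁⟩, ⟨h₂, e₂⟩, ⟨h₃, e₃⟩⟩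
    have hB : (h₁, h₂, h₃) ∈ B := by
      refine ⟨X_sub_X_dvd_of_dvd_mul hyx ⟨u + h₁, ?_⟩, X_sub_X_dvd_of_dvd_mul hzy ⟨v - h₂, ?_⟩,
        X_sub_X_dvd_of_dvd_mul hzx ⟨w - h₃, ?_⟩⟩
      · linear_combination hu - e₁ + e₂
      · linear_combination hv - e₂ + e₃
      · linear_combination hw - e₁ - e₃
    let p : DualNumber B :=
      inl ⟨(fst q.1, fst q.2.1, fst q.2.2), f₁, f₂, f₃⟩ + inr ⟨(h₁, h₂, h₃), hB⟩
    obtain ⟨p₁, p₂, p₃, p₄, p₅, p₆⟩ := hφ p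
    refine ⟨p, Prod.ext (TrivSqZeroExt.ext ?_ ?_) (Prod.ext (TrivSqZeroExt.ext ?_ ?_)
      (TrivSqZeroExt.ext ?_ ?_))⟩
    · exact p₁.trans (by simp [p])
    · exact p₂.trans (by simp [p, e₁, mul_comm])
    · exact p₃.trans (by simp [p])
    · exact p₄.trans (by simp [p, e₂, mul_comm])
    · exact p₅.trans (by simp [p])
    · exact p₆.trans (by simp [p, e₃, mul_comm])
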